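/- arXiv:1112.4857 — 2 statements merged into one kernel-verified Lean document; each statement's English description precedes it below -/
import Mathlib

section
/- Let 𝒢 be a groupoid with object set M and 𝒜 its discrete convolution algebra. For k ≥ 1 and any function φ : 𝒢_k → ℂ, define the (k+1)-linear functional χ(φ) on 𝒜 by χ(φ)(a₀,…,a_k) = Σ_{(g₁,…,g_k) ∈ 𝒢_k} a₀((g₁⋯g_k)⁻¹) φ(g₁,…,g_k) a₁(g₁) ⋯ a_k(g_k). Then χ intertwines the cyclic operators: for the operator τ_kφ(g₁,…,g_k) = φ((g₁⋯g_k)⁻¹, g₁,…,g_{k−1}) on cochains one has χ(τ_kφ)(a₀, a₁,…,a_k) = χ(φ)(a_k, a₀, a₁,…,a_{k−1}) for all a₀,…,a_k ∈ 𝒜. -/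
/-!
STATEMENT 4: For a groupoid 𝒢 with discrete convolution algebra 𝒜, the
characteristic map χ(φ)(a₀,…,a_k) = Σ_{(g₁,…,g_k) ∈ 𝒢_k} a₀((g₁⋯g_k)⁻¹)
φ(g₁,…,g_k) a₁(g₁) ⋯ a_k(g_k) intertwines the cyclic operators:
χ(τ_kφ)(a₀,…,a_k) = χ(φ)(a_k, a₀,…,a_{k−1}), where
τ_kφ(g₁,…,g_k) = φ((g₁⋯g_k)⁻¹, g₁,…,g_{k−1}).

We model 𝒢_k as `CategoryTheory.ComposableArrows C k`; an arrow is a triple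
⟨x, y, g⟩ with g : x ⟶ y; τ_kφ = φ ∘ t_k with t_k the cyclic operator; k ≥ 1 is
written k = m+1.
-/

open CategoryTheory

/-- The type of arrows of a groupoid. -/
abbrev GrpdArrow (C : Type*) [Groupoid C] := Σ x : C, Σ y : C, x ⟶ y

/-- The cyclic operator `t_k` on composable `k`-tuples in a groupoid:
`t_k(g₁,…,g_k) = ((g₁g₂⋯g_k)⁻¹, g₁,…,g_{k−1})`. -/
noncomputable def cyclicOp {C : Type*} [Groupoid C] {k : ℕ}
    (F : ComposableArrows C k) : ComposableArrows C k :=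
  ComposableArrows.mkOfObjOfMapSucc
    (fun i => match i with
      | ⟨0, _⟩ => F.obj (Fin.last k)
      | ⟨j + 1, h⟩ => F.obj ⟨j, by omega⟩)
    (fun i => match i with
      | ⟨0, _⟩ => Groupoid.inv (F.map' 0 k)
      | ⟨j + 1, h⟩ => F.map' j (j + 1))

/-- The characteristic map: χ(φ)(a₀,…,a_k) =
Σ_{(g₁,…,g_k) ∈ 𝒢_k} a₀((g₁⋯g_k)⁻¹) φ(g₁,…,g_k) a₁(g₁) ⋯ a_k(g_k). -/
noncomputable def chiMap {C : Type*} [Groupoid C] {k : ℕ}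
    (φ : ComposableArrows C k → ℂ) (a : Fin (k + 1) → GrpdArrow C → ℂ) : ℂ :=
  ∑ᶠ F : ComposableArrows C k,
    a 0 ⟨F.obj (Fin.last k), F.obj 0, Groupoid.inv (F.map' 0 k)⟩ * φ F *
      ∏ i : Fin k,
        a i.succ ⟨F.obj i.castSucc, F.obj i.succ,
          F.map (homOfLE (Fin.castSucc_lt_succ (i := i)).le)⟩

section ChiAux

open Finset

/-- The `i`-th arrow of a composable tuple. -/
def auxArr {C : Type*} [Groupoid C] {k : ℕ} (F : ComposableArrows C k) (i : Fin k) :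
    GrpdArrow C :=
  ⟨F.obj i.castSucc, F.obj i.succ, F.map (homOfLE (Fin.castSucc_lt_succ (i := i)).le)⟩

/-- The inverse of the total composite. -/
def auxTot {C : Type*} [Groupoid C] {k : ℕ} (F : ComposableArrows C k) : GrpdArrow C :=
  ⟨F.obj (Fin.last k), F.obj 0, Groupoid.inv (F.map' 0 k)⟩

/-- The extended tuple of arrows. -/
def auxExt {C : Type*} [Groupoid C] {k : ℕ} (F : ComposableArrows C k) :
    Fin (k + 1) → GrpdArrow C :=
  Fin.cons (auxTot F) (auxArr F)

theorem auxArrow_eq {C : Type*} [Groupoid C] {x y x' y' : C} (f : x ⟶ y) (g : x' ⟶ y')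
    (hx : x = x') (hy : y = y')
    (h : (⟨x, y, f⟩ : GrpdArrow C) = ⟨x', y', g⟩) :
    f = eqToHom hx ≫ g ≫ eqToHom hy.symm := by
  subst hx hy
  simpa using h

theorem auxArr_injective {C : Type*} [Groupoid C] {m : ℕ} :
    Function.Injective (auxArr (C := C) (k := m + 1)) := by
  intro F G h
  have h1 : ∀ i, F.obj i = G.obj i := by
    intro i
    induction i using Fin.cases with
    | zero => exact congrArg Sigma.fst (congrFun h 0)
    | succ j => exact congrArg (fun a : GrpdArrow C => a.2.1) (congrFun h j)
  refine ComposableArrows.ext h1 ?_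
  intro i hi
  exact auxArrow_eq _ _ (h1 _) (h1 _) (congrFun h ⟨i, hi⟩)

theorem aux_map_zero {C : Type*} [Groupoid C] {m : ℕ} (F : ComposableArrows C (m + 1)) :
    (cyclicOp F).map' 0 1 = Groupoid.inv (F.map' 0 (m + 1)) :=
  ComposableArrows.mkOfObjOfMapSucc_map_succ (C := C) (n := m + 1) _ _ 0 (by omega)

theorem auxArr_cyclic_zero {C : Type*} [Groupoid C] {m : ℕ} (F : ComposableArrows C (m + 1)) :
    auxArr (cyclicOp F) 0 = auxTot F := by
  exact congrArg (fun f => (⟨F.obj (Fin.last (m + 1)), F.obj 0, f⟩ : GrpdArrow C))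
    (aux_map_zero F)

theorem aux_map_succ {C : Type*} [Groupoid C] {m : ℕ} (F : ComposableArrows C (m + 1))
    (j : ℕ) (hj : j + 1 < m + 1) :
    (cyclicOp F).map' (j + 1) (j + 1 + 1) = F.map' j (j + 1) :=
  ComposableArrows.mkOfObjOfMapSucc_map_succ (C := C) (n := m + 1) _ _ (j + 1) hj

theorem aux_map_one {C : Type*} [Groupoid C] {m : ℕ} (F : ComposableArrows C (m + 1))
    (j : ℕ) (hj : j ≤ m) :
    (cyclicOp F).map' 1 (j + 1) = F.map' 0 j := by
  induction j with
  | zero =>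
    exact ((cyclicOp F).map'_self 1).trans (F.map'_self 0).symm
  | succ j ih =>
    rw [F.map'_comp 0 j (j + 1), (cyclicOp F).map'_comp 1 (j + 1) (j + 1 + 1)]
    have h1 := ih (by omega)
    have h2 := aux_map_succ F j (by omega)
    rw [h1, h2]
    rfl

theorem auxArr_cyclic_succ {C : Type*} [Groupoid C] {m : ℕ} (F : ComposableArrows C (m + 1))
    (i : Fin m) : auxArr (cyclicOp F) i.succ = auxArr F i.castSucc := by
  have h2 := aux_map_succ F i (by omega)
  exact congrArg (fun f => (⟨F.obj i.castSucc.castSucc, F.obj i.castSucc.succ, f⟩ :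
    GrpdArrow C)) h2

theorem auxTot_cyclic {C : Type*} [Groupoid C] {m : ℕ} (F : ComposableArrows C (m + 1)) :
    auxTot (cyclicOp F) = auxArr F (Fin.last m) := by
  have key : ∀ {x y z : C} (p : x ⟶ y) (q : y ⟶ z) (r : z ⟶ x) (t : z ⟶ y) (u : x ⟶ z),
      u = p ≫ q → r = Groupoid.inv u → t = r ≫ p → Groupoid.inv t = q := by
    intro x y z p q r t u h1 h2 h3
    subst h1 h2 h3
    simp
  refine congrArg (fun f => (⟨F.obj (Fin.last m).castSucc, F.obj (Fin.last m).succ, f⟩ :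
    GrpdArrow C)) (a₁ := Groupoid.inv ((cyclicOp F).map' 0 (m + 1))) 
    (a₂ := F.map' m (m + 1)) ?_
  refine key (F.map' 0 m) (F.map' m (m + 1)) (Groupoid.inv (F.map' 0 (m + 1))) _
    (F.map' 0 (m + 1)) (F.map'_comp 0 m (m + 1)) rfl ?_
  refine ((cyclicOp F).map'_comp 0 1 (m + 1)).trans ?_
  rw [aux_map_zero F, aux_map_one F m le_rfl]
  rfl

theorem auxExt_injective {C : Type*} [Groupoid C] {m : ℕ} :
    Function.Injective (auxExt (C := C) (k := m + 1)) := by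
  intro F G h
  apply auxArr_injective
  funext i
  simpa [auxExt] using congrFun h i.succ

theorem auxExt_cyclic_zero {C : Type*} [Groupoid C] {m : ℕ} (F : ComposableArrows C (m + 1)) :
    auxExt (cyclicOp F) 0 = auxExt F (Fin.last (m + 1)) := by
  rw [← Fin.succ_last]
  simpa [auxExt] using auxTot_cyclic F

theorem auxExt_cyclic_succ {C : Type*} [Groupoid C] {m : ℕ} (F : ComposableArrows C (m + 1))
    (i : Fin (m + 1)) : auxExt (cyclicOp F) i.succ = auxExt F i.castSucc := by
  induction i using Fin.cases with
  | zero => simpa [auxExt] using auxArr_cyclic_zero F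
  | succ j =>
    rw [← Fin.succ_castSucc]
    simpa [auxExt] using auxArr_cyclic_succ F j

theorem auxExt_cyclic {C : Type*} [Groupoid C] {m : ℕ} (F : ComposableArrows C (m + 1))
    (i : Fin (m + 2)) : auxExt (cyclicOp F) i = auxExt F (i - 1) := by
  induction i using Fin.cases with
  | zero =>
    rw [auxExt_cyclic_zero]
    congr 1
    rw [eq_sub_iff_add_eq]
    simp
  | succ j =>
    rw [auxExt_cyclic_succ]
    congr 1
    rw [eq_sub_iff_add_eq]
    simp

theorem auxExt_iterate {C : Type*} [Groupoid C] {m : ℕ} (n : ℕ)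
    (F : ComposableArrows C (m + 1)) (i : Fin (m + 2)) :
    auxExt (cyclicOp^[n] F) i = auxExt F (i - n • (1 : Fin (m + 2))) := by
  induction n generalizing i with
  | zero => simp
  | succ n ih =>
    rw [Function.iterate_succ_apply', auxExt_cyclic, ih]
    congr 1
    rw [succ_nsmul]
    abel

theorem cyclicOp_iterate {C : Type*} [Groupoid C] {m : ℕ} :
    (cyclicOp (C := C) (k := m + 1))^[m + 2] = id := by
  funext F
  apply auxExt_injective
  funext i
  rw [auxExt_iterate]
  simp only [id]
  congr 1
  have h := card_nsmul_eq_zero' (G := Fin (m + 2)) (x := 1)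
  rw [Nat.card_eq_fintype_card, Fintype.card_fin] at h
  rw [h, sub_zero]

theorem cyclicOp_bijective {C : Type*} [Groupoid C] {m : ℕ} :
    Function.Bijective (cyclicOp (C := C) (k := m + 1)) := by
  constructor
  · intro F G h
    have := congrArg (cyclicOp^[m + 1]) h
    rw [← Function.iterate_succ_apply, ← Function.iterate_succ_apply, cyclicOp_iterate] at this
    exact this
  · intro F
    refine ⟨cyclicOp^[m + 1] F, ?_⟩
    exact (Function.iterate_succ_apply' cyclicOp (m + 1) F).symm.trans
      (congrFun cyclicOp_iterate F)

theorem chiMap_eq {C : Type*} [Groupoid C] {k : ℕ}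
    (φ : ComposableArrows C k → ℂ) (a : Fin (k + 1) → GrpdArrow C → ℂ) :
    chiMap φ a = ∑ᶠ F : ComposableArrows C k, φ F * ∏ i, a i (auxExt F i) := by
  unfold chiMap
  refine finsum_congr fun F => ?_
  rw [Fin.prod_univ_succ]
  simp only [auxExt, Fin.cons_zero, Fin.cons_succ, auxTot, auxArr]
  ring

end ChiAux

theorem chiMap_cyclic {C : Type*} [Groupoid C] (m : ℕ)
    (φ : ComposableArrows C (m + 1) → ℂ)
    (a : Fin (m + 2) → GrpdArrow C → ℂ)
    (ha : ∀ i, (Function.support (a i)).Finite) :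
    chiMap (fun F => φ (cyclicOp F)) a
      = chiMap φ
          (Fin.cons (a (Fin.last (m + 1))) (fun i : Fin (m + 1) => a i.castSucc)) := by
  rw [chiMap_eq, chiMap_eq]
  refine finsum_eq_of_bijective cyclicOp cyclicOp_bijective fun F => ?_
  congr 1
  rw [Fin.prod_univ_castSucc, Fin.prod_univ_succ (n := m + 1)]
  rw [auxExt_cyclic_zero]
  simp only [Fin.cons_zero, Fin.cons_succ, auxExt_cyclic_succ]
  ring
end

section
/- Let 𝒢 be a groupoid with object set M, let k ≥ 1, let ψ be a right-invariant ℂ-valued function on 𝒢^{×_t(k+1)}, and let ψ̃ be the associated inhomogeneous cochain ψ̃(g₁,…,g_k) = ψ(g₁g₂⋯g_k, g₂⋯g_k, …, g_k, 1_{t(g_k)}). Then for all finitely supported functions a₀,…,a_k on the arrows of 𝒢, the characteristic pairing evaluates as χ(ψ̃)(a₀,…,a_k) = Σ_{x ∈ M} Σ_{(h₁,…,h_k) : t(h₁) = ⋯ = t(h_k) = x} a₀(h₁⁻¹) · ψ(h₁, h₂, …, h_k, 1_x) · a₁(h₁h₂⁻¹) · a₂(h₂h₃⁻¹) ⋯ a_{k−1}(h_{k−1}h_k⁻¹)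 · a_k(h_k). -/
/-!
STATEMENT 10: Let 𝒢 be a groupoid with object set M, k ≥ 1, ψ a right-invariant
function on 𝒢^{×_t(k+1)}, and ψ̃ the associated inhomogeneous cochain
ψ̃(g₁,…,g_k) = ψ(g₁g₂⋯g_k, g₂⋯g_k, …, g_k, 1_{t(g_k)}).  Then for all finitely
supported a₀,…,a_k on the arrows,
χ(ψ̃)(a₀,…,a_k) = Σ_{x ∈ M} Σ_{(h₁,…,h_k) : t(h₁)=⋯=t(h_k)=x}
  a₀(h₁⁻¹) ψ(h₁,…,h_k,1_x) a₁(h₁h₂⁻¹) ⋯ a_{k−1}(h_{k−1}h_k⁻¹) a_k(h_k).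

Modelling: 𝒢_k is `ComposableArrows C k`; an arrow is a triple ⟨x, y, g⟩;
a tuple with common target x is a function `Fin (k+1) → Σ y : C, y ⟶ x`;
χ(φ)(a₀,…,a_k) = Σ_{(g₁,…,g_k) ∈ 𝒢_k} a₀((g₁⋯g_k)⁻¹) φ(g₁,…,g_k) a₁(g₁)⋯a_k(g_k);
k ≥ 1 is written k = m+1, and on the right-hand side the k-tuple (h₁,…,h_k) is
`h : Fin (m+1) → Σ y : C, y ⟶ x` (so h_i = h (i−1)), with (h₁,…,h_k,1_x)
obtained by appending the identity via `Fin.snoc`.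
-/

open CategoryTheory

/-- Tuples of k+1 arrows with common target. -/
abbrev HTuple (C : Type*) [Groupoid C] (k : ℕ) :=
  Σ p : C, Fin (k + 1) → Σ y : C, y ⟶ p

/-- Right-invariance of a function on tuples with common target. -/
def IsRightInvariant {C : Type*} [Groupoid C] {k : ℕ} (ψ : HTuple C k → ℂ) : Prop :=
  ∀ (p q : C) (g : Fin (k + 1) → Σ y : C, y ⟶ p) (h : p ⟶ q),
    ψ ⟨q, fun i => ⟨(g i).1, (g i).2 ≫ h⟩⟩ = ψ ⟨p, g⟩

/-- ψ ↦ ψ̃ : the inhomogeneous cochain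
ψ̃(g₁,…,g_k) = ψ(g₁⋯g_k, g₂⋯g_k, …, g_k, 1_{t(g_k)}). -/
def tildeMap {C : Type*} [Groupoid C] {k : ℕ}
    (ψ : HTuple C k → ℂ) (F : ComposableArrows C k) : ℂ :=
  ψ ⟨F.obj (Fin.last k), fun i => ⟨F.obj i, F.map (homOfLE (Fin.le_last i))⟩⟩

theorem finsum_sigma_aux {α : Type*} {β : α → Type*} (f : (Σ a, β a) → ℂ)
    (hf : (Function.support f).Finite) : ∑ᶠ p, f p = ∑ᶠ (a : α) (b : β a), f ⟨a, b⟩ := by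
  classical
  set s := hf.toFinset with hs
  have hmem : ∀ p, f p ≠ 0 → p ∈ s := fun p hp => by simpa [hs] using hp
  let T : (a : α) → Finset (β a) := fun a => s.preimage (Sigma.mk a)
    (fun x _ y _ h => sigma_mk_injective h)
  have hT : ∀ a b, b ∈ T a ↔ (⟨a, b⟩ : Σ a, β a) ∈ s := fun a b => Finset.mem_preimage
  let t : Finset α := s.image Sigma.fst
  have h1 : ∀ a, ∑ᶠ b : β a, f ⟨a, b⟩ = ∑ b ∈ T a, f ⟨a, b⟩ := fun a =>
    finsum_eq_sum_of_support_subset _ (fun b hb => by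
      exact Finset.mem_coe.2 ((hT a b).2 (hmem _ hb)))
  have h2 : ∑ᶠ p, f p = ∑ p ∈ t.sigma T, f p :=
    finsum_eq_sum_of_support_subset _ (fun p hp => by
      have := hmem p hp
      simp only [Finset.coe_sigma, Set.mem_sigma_iff, Finset.mem_coe, t, hT,
        Finset.mem_image]
      exact ⟨⟨p, this, rfl⟩, this⟩)
  rw [h2, Finset.sum_sigma]
  simp_rw [h1]
  symm
  apply finsum_eq_sum_of_support_subset
  intro a ha
  obtain ⟨b, hb, -⟩ := Finset.exists_ne_zero_of_sum_ne_zero (Function.mem_support.1 ha)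
  rw [hT] at hb
  simp only [t, Finset.coe_image, Set.mem_image, Finset.mem_coe]
  exact ⟨_, hb, rfl⟩

/-- Composable arrows to tuple with common target. -/
def toTup {C : Type*} [Groupoid C] {m : ℕ} (F : ComposableArrows C (m + 1)) :
    Σ x : C, Fin (m + 1) → Σ y : C, y ⟶ x :=
  ⟨F.obj (Fin.last (m + 1)), fun i => ⟨F.obj i.castSucc, F.map (homOfLE (Fin.le_last _))⟩⟩

/-- Tuple with common target to composable arrows. -/
def ofTup {C : Type*} [Groupoid C] {k : ℕ} {x : C} (t : Fin (k + 1) → Σ y : C, y ⟶ x) :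
    ComposableArrows C k where
  obj i := (t i).1
  map {i j} _ := (t i).2 ≫ Groupoid.inv (t j).2
  map_id i := by simp
  map_comp f g := by simp

theorem snoc_toTup {C : Type*} [Groupoid C] {m : ℕ} (F : ComposableArrows C (m + 1)) :
    (Fin.snoc (toTup F).2 ⟨(toTup F).1, 𝟙 _⟩ : Fin (m + 2) → Σ y : C, y ⟶ (toTup F).1) =
      fun i => ⟨F.obj i, F.map (homOfLE (Fin.le_last i))⟩ := by
  funext i
  induction i using Fin.lastCases with
  | last =>
    rw [Fin.snoc_last]
    exact congrArg (Sigma.mk _) (F.map_id _).symm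
  | cast i =>
    rw [Fin.snoc_castSucc]
    rfl

theorem arrows_map_div {C : Type*} [Groupoid C] {k : ℕ} (F : ComposableArrows C k) {i j : Fin (k + 1)}
    (f : i ⟶ j) : F.map (homOfLE (Fin.le_last i)) ≫ Groupoid.inv (F.map (homOfLE (Fin.le_last j)))
      = F.map f := by
  have : F.map (homOfLE (Fin.le_last i)) = F.map f ≫ F.map (homOfLE (Fin.le_last j)) := by
    rw [← F.map_comp]; rfl
  rw [this, Category.assoc, Groupoid.comp_inv, Category.comp_id]

theorem ofTup_toTup {C : Type*} [Groupoid C] {m : ℕ} (F : ComposableArrows C (m + 1)) :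
    ofTup (Fin.snoc (toTup F).2 ⟨(toTup F).1, 𝟙 _⟩ :
      Fin (m + 2) → Σ y : C, y ⟶ (toTup F).1) = F := by
  rw [snoc_toTup]
  refine CategoryTheory.Functor.ext (fun _ => rfl) ?_
  intro i j f
  have e : F.map f = 𝟙 _ ≫ F.map f ≫ 𝟙 _ := by simp
  exact (arrows_map_div F f).trans e

theorem toTup_ofTup {C : Type*} [Groupoid C] {m : ℕ} (x : C) (h : Fin (m + 1) → Σ y : C, y ⟶ x) :
    toTup (ofTup (Fin.snoc h ⟨x, 𝟙 x⟩ : Fin (m + 2) → Σ y : C, y ⟶ x)) = ⟨x, h⟩ := by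
  have key : ∀ s : (Σ y : C, y ⟶ x), s = ⟨x, 𝟙 x⟩ →
      (⟨s.1, fun i => ⟨(h i).1, (h i).2 ≫ Groupoid.inv s.2⟩⟩ :
        Σ x : C, Fin (m + 1) → Σ y : C, y ⟶ x) = ⟨x, h⟩ := by
    rintro s rfl
    have : Groupoid.inv (𝟙 x) = 𝟙 x := by simp
    simp only [this, Category.comp_id]
  refine Eq.trans ?_ (key ((Fin.snoc h ⟨x, 𝟙 x⟩ : Fin (m + 2) → Σ y : C, y ⟶ x) (Fin.last _))
    (Fin.snoc_last (α := fun _ => Σ y : C, y ⟶ x) _ _))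
  unfold toTup
  refine congrArg (Sigma.mk _) ?_
  funext i
  simp only [ofTup]
  rw [Fin.snoc_castSucc (α := fun _ => Σ y : C, y ⟶ x)]

/-- The change of variables. -/
def tupEquiv (C : Type*) [Groupoid C] (m : ℕ) :
    ComposableArrows C (m + 1) ≃ Σ x : C, Fin (m + 1) → Σ y : C, y ⟶ x where
  toFun := toTup
  invFun p := ofTup (Fin.snoc p.2 ⟨p.1, 𝟙 _⟩ : Fin (m + 2) → Σ y : C, y ⟶ p.1)
  left_inv := ofTup_toTup
  right_inv p := toTup_ofTup p.1 p.2

theorem arrows_inj {C : Type*} [Groupoid C] {m : ℕ} : Function.Injective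
    (fun (F : ComposableArrows C (m + 1)) (i : Fin (m + 1)) =>
      (⟨F.obj i.castSucc, F.obj i.succ,
          F.map (homOfLE (Fin.castSucc_lt_succ (i := i)).le)⟩ : GrpdArrow C)) := by
  intro F G h
  have h' := fun i => congrFun h i
  simp only [Sigma.mk.injEq] at h'
  have ho : ∀ i, F.obj i = G.obj i := by
    intro i
    induction i using Fin.cases with
    | zero => exact (h' 0).1
    | succ i =>
      have := congrArg (fun p : GrpdArrow C => p.2.1) (congrFun h i)
      exact this
  refine ComposableArrows.ext ho ?_
  intro i hi
  rw [conj_eqToHom_iff_heq']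
  have key : ∀ p q : GrpdArrow C, p = q → p.2.2 ≍ q.2.2 := by
    rintro p q rfl; rfl
  exact key _ _ (congrFun h ⟨i, hi⟩)

theorem chiMap_tilde_eval {C : Type*} [Groupoid C] (m : ℕ)
    (ψ : HTuple C (m + 1) → ℂ) (hψ : IsRightInvariant ψ)
    (a : Fin (m + 2) → GrpdArrow C → ℂ)
    (ha : ∀ i, (Function.support (a i)).Finite) :
    chiMap (tildeMap ψ) a
      = ∑ᶠ (x : C) (h : Fin (m + 1) → Σ y : C, y ⟶ x),
          a 0 ⟨x, (h 0).1, Groupoid.inv (h 0).2⟩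
            * ψ ⟨x, Fin.snoc h ⟨x, 𝟙 x⟩⟩
            * (∏ j : Fin m,
                a j.succ.castSucc
                  ⟨(h j.castSucc).1, (h j.succ).1,
                    (h j.castSucc).2 ≫ Groupoid.inv (h j.succ).2⟩)
            * a (Fin.last (m + 1)) ⟨(h (Fin.last m)).1, x, (h (Fin.last m)).2⟩ := by
  have hfin : (Function.support fun F : ComposableArrows C (m + 1) =>
      a 0 ⟨F.obj (Fin.last (m + 1)), F.obj 0, Groupoid.inv (F.map' 0 (m + 1))⟩ * tildeMap ψ F *
      ∏ i : Fin (m + 1),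
        a i.succ ⟨F.obj i.castSucc, F.obj i.succ,
          F.map (homOfLE (Fin.castSucc_lt_succ (i := i)).le)⟩).Finite := by
    refine ((Set.Finite.pi' (fun i : Fin (m + 1) => ha i.succ)).preimage
      (arrows_inj.injOn)).subset ?_
    intro F hF i
    have := right_ne_zero_of_mul (Function.mem_support.1 hF)
    exact Finset.prod_ne_zero_iff.1 this i (Finset.mem_univ i)
  let g : (Σ x : C, Fin (m + 1) → Σ y : C, y ⟶ x) → ℂ := fun p =>
    a 0 ⟨p.1, (p.2 0).1, Groupoid.inv (p.2 0).2⟩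
            * ψ ⟨p.1, Fin.snoc p.2 ⟨p.1, 𝟙 p.1⟩⟩
            * (∏ j : Fin m,
                a j.succ.castSucc
                  ⟨(p.2 j.castSucc).1, (p.2 j.succ).1,
                    (p.2 j.castSucc).2 ≫ Groupoid.inv (p.2 j.succ).2⟩)
            * a (Fin.last (m + 1)) ⟨(p.2 (Fin.last m)).1, p.1, (p.2 (Fin.last m)).2⟩
  have hg : ∀ F : ComposableArrows C (m + 1), 
      a 0 ⟨F.obj (Fin.last (m + 1)), F.obj 0, Groupoid.inv (F.map' 0 (m + 1))⟩ * tildeMap ψ F *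
      ∏ i : Fin (m + 1),
        a i.succ ⟨F.obj i.castSucc, F.obj i.succ,
          F.map (homOfLE (Fin.castSucc_lt_succ (i := i)).le)⟩ = g (tupEquiv C m F) := by
    intro F
    change _ = g (toTup F)
    simp only [g]
    rw [snoc_toTup, Fin.prod_univ_castSucc, ← mul_assoc]
    refine congrArg₂ _ (congrArg₂ _ rfl (Finset.prod_congr rfl fun j _ => ?_)) rfl
    refine congrArg (a j.succ.castSucc) ?_
    refine congrArg (Sigma.mk _) (congrArg (Sigma.mk _) ?_)
    exact (arrows_map_div F (i := j.castSucc.castSucc) (j := j.succ.castSucc)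
      (homOfLE (Fin.castSucc_lt_succ (i := j.castSucc)).le)).symm
  unfold chiMap
  simp_rw [hg] at hfin ⊢
  rw [finsum_comp_equiv (tupEquiv C m) (f := g)]
  refine finsum_sigma_aux g ?_
  refine (hfin.image (tupEquiv C m)).subset ?_
  intro p hp
  exact ⟨(tupEquiv C m).symm p, by simpa using hp, by simp⟩
end
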